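/- arXiv:1109.5240 — 4 statements merged into one kernel-verified Lean document; each statement's English description precedes it below -/
import Mathlib

section
/- Let n_x, n_u, m be positive integers and let A : ℝ → Mat(n_x,n_x,ℝ), B : ℝ → Mat(n_x,n_u,ℝ), fp : ℝ → ℝ^{n_x}, P : ℝ → Mat(n_x,n_x,ℝ), S : ℝ → Mat(n_u,n_x,ℝ), q : ℝ → ℝ^{n_u}, N : ℝ → ℝ^{n_x}, and M : ℝ → Mat(n_u,n_u,ℝ) be functions such that for every t, M(t) is symmetric and invertible. Define the feedback gains β(t) = −M(t)⁻¹·(S(t) + B(t)ᵀ·R(t)), γ(t) = −M(t)⁻¹·(q(t) + B(t)ᵀ·T(t)), ω(t) = −M(t)⁻¹·(B(t)ᵀ·K(t)). Suppose R : ℝ → Mat(n_x,n_x,ℝ), K : ℝ → Mat(n_x,m,ℝ), T : ℝ → ℝ^{n_x} are differentiable with, for every t: R(t) symmetric, −R′(t) = P(t) + A(t)ᵀ·R(t) + R(t)·A(t) + β(t)ᵀ·(S(t) + B(t)ᵀ·R(t)); −K′(t) = (A(t) + B(t)·β(t))ᵀ·K(t); −T′(t) = N(t) + A(t)ᵀ·T(t)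 + (S(t) + B(t)ᵀ·R(t))ᵀ·γ(t) + R(t)ᵀ·fp(t). Fix dν ∈ ℝᵐ and dp ∈ ℝ and let δx : ℝ → ℝ^{n_x} be differentiable with δx′(t) = A(t)·δx(t) + B(t)·δu(t) + fp(t)·dp, where δu(t) = β(t)·δx(t) + γ(t)·dp + ω(t)·dν. Then the function δλ(t) := R(t)·δx(t) + K(t)·dν + T(t)·dp satisfies the linearized adjoint (costate variational) equation −δλ′(t) = P(t)·δx(t) + S(t)ᵀ·δu(t) + N(t)·dp + A(t)ᵀ·δλ(t) for every t. -/
open Matrix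

attribute [local instance] Matrix.normedAddCommGroup Matrix.normedSpace

/-- Entrywise form of differentiability for a matrix-valued function. -/
lemma HasDerivAt.matrix_apply {m n : ℕ} {R : ℝ → Matrix (Fin m) (Fin n) ℝ}
    {R' : Matrix (Fin m) (Fin n) ℝ} {t : ℝ} (hR : HasDerivAt R R' t) (i : Fin m) (j : Fin n) :
    HasDerivAt (fun s => R s i j) (R' i j) t :=
  hasDerivAt_pi.1 (hasDerivAt_pi.1 hR i) j

/-- Product rule for the matrix-vector product. -/
lemma HasDerivAt.matrix_mulVec {m n : ℕ} {R : ℝ → Matrix (Fin m) (Fin n) ℝ}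
    {R' : Matrix (Fin m) (Fin n) ℝ} {x : ℝ → Fin n → ℝ} {x' : Fin n → ℝ} {t : ℝ}
    (hR : HasDerivAt R R' t) (hx : HasDerivAt x x' t) :
    HasDerivAt (fun s => (R s).mulVec (x s)) (R'.mulVec (x t) + (R t).mulVec x') t := by
  refine hasDerivAt_pi.2 fun i => ?_
  simp only [Pi.add_apply, Matrix.mulVec, dotProduct, ← Finset.sum_add_distrib]
  exact HasDerivAt.fun_sum fun j _ => (hR.matrix_apply i j).mul (hasDerivAt_pi.1 hx j)

/-- Differential-equation content of the Riccati transformation lemma: if `R`, `K`, `T`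
satisfy the backward Riccati-type ODEs and `δx` satisfies the linearized state equation
under the feedback control update `δu = β δx + γ dp + ω dν`, then
`δλ = R δx + K dν + T dp` satisfies the linearized adjoint (costate variational)
equation `-δλ' = P δx + Sᵀ δu + N dp + Aᵀ δλ`. -/
theorem riccati_ode_costate
    (nx nu m : ℕ) (hnx : 0 < nx) (hnu : 0 < nu) (hm : 0 < m)
    (A : ℝ → Matrix (Fin nx) (Fin nx) ℝ) (B : ℝ → Matrix (Fin nx) (Fin nu) ℝ)
    (fp : ℝ → Fin nx → ℝ)
    (P : ℝ → Matrix (Fin nx) (Fin nx) ℝ) (S : ℝ → Matrix (Fin nu) (Fin nx) ℝ)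
    (q : ℝ → Fin nu → ℝ) (N : ℝ → Fin nx → ℝ)
    (M : ℝ → Matrix (Fin nu) (Fin nu) ℝ)
    (hM : ∀ t, (M t).IsSymm ∧ IsUnit (M t))
    (R : ℝ → Matrix (Fin nx) (Fin nx) ℝ) (K : ℝ → Matrix (Fin nx) (Fin m) ℝ)
    (T : ℝ → Fin nx → ℝ)
    (R' : ℝ → Matrix (Fin nx) (Fin nx) ℝ) (K' : ℝ → Matrix (Fin nx) (Fin m) ℝ)
    (T' : ℝ → Fin nx → ℝ)
    (β : ℝ → Matrix (Fin nu) (Fin nx) ℝ) (γ : ℝ → Fin nu → ℝ)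
    (ω : ℝ → Matrix (Fin nu) (Fin m) ℝ)
    (hβ : ∀ t, β t = -((M t)⁻¹ * (S t + (B t)ᵀ * R t)))
    (hγ : ∀ t, γ t = -((M t)⁻¹.mulVec (q t + (B t)ᵀ.mulVec (T t))))
    (hω : ∀ t, ω t = -((M t)⁻¹ * ((B t)ᵀ * K t)))
    (hRsym : ∀ t, (R t).IsSymm)
    (hR : ∀ t, HasDerivAt R (R' t) t)
    (hK : ∀ t, HasDerivAt K (K' t) t)
    (hT : ∀ t, HasDerivAt T (T' t) t)
    (hR' : ∀ t, -R' t
      = P t + (A t)ᵀ * R t + R t * A t + (β t)ᵀ * (S t + (B t)ᵀ * R t))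
    (hK' : ∀ t, -K' t = (A t + B t * β t)ᵀ * K t)
    (hT' : ∀ t, -T' t
      = N t + (A t)ᵀ.mulVec (T t) + (S t + (B t)ᵀ * R t)ᵀ.mulVec (γ t)
        + (R t)ᵀ.mulVec (fp t))
    (dν : Fin m → ℝ) (dp : ℝ)
    (δx : ℝ → Fin nx → ℝ) (δu : ℝ → Fin nu → ℝ)
    (hδu : ∀ t, δu t = (β t).mulVec (δx t) + dp • γ t + (ω t).mulVec dν)
    (hδx : ∀ t, HasDerivAt δx
      ((A t).mulVec (δx t) + (B t).mulVec (δu t) + dp • fp t) t) :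
    ∀ t, HasDerivAt (fun s => (R s).mulVec (δx s) + (K s).mulVec dν + dp • T s)
      (-((P t).mulVec (δx t) + (S t)ᵀ.mulVec (δu t) + dp • N t
        + (A t)ᵀ.mulVec ((R t).mulVec (δx t) + (K t).mulVec dν + dp • T t))) t := by
  intro t
  have hMinv : ((M t)⁻¹)ᵀ = (M t)⁻¹ := by rw [Matrix.transpose_nonsing_inv, (hM t).1]
  have hβQ : (β t)ᵀ * (S t + (B t)ᵀ * R t) = (S t + (B t)ᵀ * R t)ᵀ * β t := by
    rw [hβ, Matrix.transpose_neg, Matrix.transpose_mul, hMinv, Matrix.neg_mul, Matrix.mul_neg,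
      Matrix.mul_assoc]
  have hβK : (β t)ᵀ * ((B t)ᵀ * K t) = (S t + (B t)ᵀ * R t)ᵀ * ω t := by
    rw [hβ, hω, Matrix.transpose_neg, Matrix.transpose_mul, hMinv, Matrix.neg_mul,
      Matrix.mul_neg, Matrix.mul_assoc]
  have hQ : (S t + (B t)ᵀ * R t)ᵀ = (S t)ᵀ + R t * B t := by
    rw [Matrix.transpose_add, Matrix.transpose_mul, Matrix.transpose_transpose, hRsym t]
  have hRt : R' t = -(P t + (A t)ᵀ * R t + R t * A t + ((S t)ᵀ + R t * B t) * β t) := by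
    rw [← hQ, ← hβQ, ← hR', neg_neg]
  have hKt : K' t = -((A t)ᵀ * K t + ((S t)ᵀ + R t * B t) * ω t) := by
    rw [← hQ, ← hβK, ← neg_neg (K' t), hK', Matrix.transpose_add, Matrix.transpose_mul,
      Matrix.add_mul, Matrix.mul_assoc]
  have hTt : T' t = -(N t + (A t)ᵀ.mulVec (T t) + ((S t)ᵀ + R t * B t).mulVec (γ t)
      + (R t).mulVec (fp t)) := by
    rw [← neg_neg (T' t), hT', hQ, hRsym t]
  refine ((((hR t).matrix_mulVec (hδx t)).add
    ((hK t).matrix_mulVec (hasDerivAt_const t dν))).add ((hT t).const_smul dp)).congr_deriv ?_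
  rw [hRt, hKt, hTt, hδu]
  simp only [Matrix.mulVec_add, Matrix.add_mulVec, Matrix.neg_mulVec, Matrix.mulVec_smul,
    Matrix.mulVec_zero, Matrix.add_mul, ← Matrix.mulVec_mulVec]
  module
end

section
/- Let n_x, n_u, m be positive integers and let A : ℝ → Mat(n_x,n_x,ℝ), B : ℝ → Mat(n_x,n_u,ℝ), fp : ℝ → ℝ^{n_x} be functions, and let β : ℝ → Mat(n_u,n_x,ℝ), γ : ℝ → ℝ^{n_u}, ω : ℝ → Mat(n_u,m,ℝ) be arbitrary functions. Suppose K : ℝ → Mat(n_x,m,ℝ), Q : ℝ → Mat(m,m,ℝ), V : ℝ → ℝᵐ are differentiable with, for every t: −K′(t) = (A(t) + B(t)·β(t))ᵀ·K(t); −Q′(t) = K(t)ᵀ·B(t)·ω(t); −V′(t) = K(t)ᵀ·(B(t)·γ(t) + fp(t)). Fix dν ∈ ℝᵐ and dp ∈ ℝ and let δx : ℝ → ℝ^{n_x} be differentiable with δx′(t) = A(t)·δx(t) + B(t)·(β(t)·δx(t) + γ(t)·dp + ω(t)·dν) + fp(t)·dp. Then the function t ↦ K(t)ᵀ·δx(t)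 + Q(t)·dν + V(t)·dp is constant (its derivative is zero for every t). -/
open Matrix

attribute [local instance] Matrix.normedAddCommGroup Matrix.normedSpace

/-- Product rule for a transposed matrix applied to a vector. -/
theorem HasDerivAt.transpose_mulVec {n m : ℕ} {M : ℝ → Matrix (Fin n) (Fin m) ℝ}
    {M' : Matrix (Fin n) (Fin m) ℝ} {v : ℝ → Fin n → ℝ} {v' : Fin n → ℝ} {t : ℝ}
    (hM : HasDerivAt M M' t) (hv : HasDerivAt v v' t) :
    HasDerivAt (fun s => (M s)ᵀ.mulVec (v s)) (M'ᵀ.mulVec (v t) + (M t)ᵀ.mulVec v') t := by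
  refine hasDerivAt_pi.2 fun i => ?_
  have hM_entry (j : Fin n) : HasDerivAt (fun s => M s j i) (M' j i) t :=
    hasDerivAt_pi.1 (hasDerivAt_pi.1 hM j) i
  simp only [Pi.add_apply, mulVec, dotProduct, transpose_apply, ← Finset.sum_add_distrib]
  exact HasDerivAt.fun_sum fun j _ => (hM_entry j).mul (hasDerivAt_pi.1 hv j)

/-- Differentiation commutes with applying a matrix to a fixed vector. -/
theorem HasDerivAt.mulVec_const {n m : ℕ} {M : ℝ → Matrix (Fin n) (Fin m) ℝ}
    {M' : Matrix (Fin n) (Fin m) ℝ} {t : ℝ} (hM : HasDerivAt M M' t) (v : Fin m → ℝ) :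
    HasDerivAt (fun s => (M s).mulVec v) (M'.mulVec v) t := by
  refine hasDerivAt_pi.2 fun i => ?_
  have hM_entry (j : Fin m) : HasDerivAt (fun s => M s i j) (M' i j) t :=
    hasDerivAt_pi.1 (hasDerivAt_pi.1 hM i) j
  simp only [mulVec, dotProduct]
  exact HasDerivAt.fun_sum fun j _ => (hM_entry j).mul_const (v j)

/-- Content of the transformation `dψ = Kᵀ δx + Q dν + V dp`: if `K`, `Q`, `V` satisfy
the backward ODEs and `δx` satisfies the linearized state equation under the feedback
control update `δu = β δx + γ dp + ω dν`, then `t ↦ K(t)ᵀ δx(t) + Q(t) dν + V(t) dp`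
is constant (its derivative is zero for every `t`). -/
theorem constraint_sensitivity_constant
    (nx nu m : ℕ) (hnx : 0 < nx) (hnu : 0 < nu) (hm : 0 < m)
    (A : ℝ → Matrix (Fin nx) (Fin nx) ℝ) (B : ℝ → Matrix (Fin nx) (Fin nu) ℝ)
    (fp : ℝ → Fin nx → ℝ)
    (β : ℝ → Matrix (Fin nu) (Fin nx) ℝ) (γ : ℝ → Fin nu → ℝ)
    (ω : ℝ → Matrix (Fin nu) (Fin m) ℝ)
    (K : ℝ → Matrix (Fin nx) (Fin m) ℝ) (Q : ℝ → Matrix (Fin m) (Fin m) ℝ)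
    (V : ℝ → Fin m → ℝ)
    (K' : ℝ → Matrix (Fin nx) (Fin m) ℝ) (Q' : ℝ → Matrix (Fin m) (Fin m) ℝ)
    (V' : ℝ → Fin m → ℝ)
    (hK : ∀ t, HasDerivAt K (K' t) t)
    (hQ : ∀ t, HasDerivAt Q (Q' t) t)
    (hV : ∀ t, HasDerivAt V (V' t) t)
    (hK' : ∀ t, -K' t = (A t + B t * β t)ᵀ * K t)
    (hQ' : ∀ t, -Q' t = (K t)ᵀ * (B t * ω t))
    (hV' : ∀ t, -V' t = (K t)ᵀ.mulVec ((B t).mulVec (γ t) + fp t))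
    (dν : Fin m → ℝ) (dp : ℝ)
    (δx : ℝ → Fin nx → ℝ)
    (hδx : ∀ t, HasDerivAt δx
      ((A t).mulVec (δx t)
        + (B t).mulVec ((β t).mulVec (δx t) + dp • γ t + (ω t).mulVec dν)
        + dp • fp t) t) :
    ∀ t, HasDerivAt (fun s => (K s)ᵀ.mulVec (δx s) + (Q s).mulVec dν + dp • V s)
      0 t := by
  intro t
  have hd := (((hK t).transpose_mulVec (hδx t)).add ((hQ t).mulVec_const dν)).add
    ((hV t).const_smul dp)
  refine hd.congr_deriv ?_
  rw [← neg_neg (K' t), ← neg_neg (Q' t), ← neg_neg (V' t), hK', hQ', hV']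
  simp only [transpose_neg, transpose_mul, transpose_transpose, neg_mulVec, ← mulVec_mulVec,
    add_mulVec, mulVec_add, mulVec_smul, smul_neg, smul_add]
  abel
end

section
/- Consider the double integrator control system p′(t) = v(t), v′(t) = u(t) on an interval [0, T], with initial conditions p(0) = 1, v(0) = 1, where u : [0, T] → ℝ is measurable with |u(t)| ≤ 1 for almost every t. Let T = 1 + √6 and t₁ = 1 + √6/2, and define the bang-bang control u(t) = −1 for t ∈ [0, t₁) and u(t) = 1 for t ∈ [t₁, T]. Then the resulting trajectory satisfies p(T) = 0 and v(T) = 0; that is, the state (1, 1) is steered to the origin (0, 0) in time exactly 1 + √6 by an admissible bang-bang control with a single switching at t₁ = 1 + √6/2. -/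
/-- A function which is continuous on `[a, b]` and has the affine derivative `c + k * (t - a)` on
`(a, b)` is the corresponding quadratic polynomial on `[a, b]`. -/
theorem eq_quadratic_of_hasDerivAt_affine {f : ℝ → ℝ} {a b c k : ℝ}
    (hf : ContinuousOn f (Set.Icc a b))
    (hd : ∀ t ∈ Set.Ioo a b, HasDerivAt f (c + k * (t - a)) t) :
    ∀ t ∈ Set.Icc a b, f t = f a + c * (t - a) + k * (t - a) ^ 2 / 2 := by
  rintro t ⟨hat, htb⟩
  rcases hat.eq_or_lt with rfl | hat
  · ring
  have hq (s : ℝ) : HasDerivAt (fun s => c * (s - a) + k * (s - a) ^ 2 / 2)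
      (c + k * (s - a)) s := by
    have h := (hasDerivAt_id s).sub_const a
    refine ((h.const_mul c).fun_add (((h.fun_pow 2).const_mul k).div_const 2)).congr_deriv ?_
    simp only [id]
    push_cast
    ring
  obtain ⟨s, -, hs⟩ := exists_hasDerivAt_eq_slope
    (fun s => f s - (c * (s - a) + k * (s - a) ^ 2 / 2)) (fun _ => 0) hat
    ((hf.mono (Set.Icc_subset_Icc_right htb)).sub fun s _ => (hq s).continuousAt.continuousWithinAt)
    fun s hs => ((hd s ⟨hs.1, hs.2.trans_le htb⟩).fun_sub (hq s)).congr_deriv (sub_self _)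
  rw [eq_comm, div_eq_zero_iff, or_iff_left (sub_pos.2 hat).ne'] at hs
  linear_combination hs

/-- Double integrator, attainability: the bang-bang control `u = -1` on `[0, t₁)`,
`u = 1` on `[t₁, T]` with `t₁ = 1 + √6/2` steers the state `(p, v) = (1, 1)` to the
origin in time `T = 1 + √6`: any trajectory of `p' = v`, `v' = u` with `p 0 = 1`,
`v 0 = 1` satisfies `p T = 0` and `v T = 0`. -/
theorem doubleIntegrator_bangBang_steers_to_origin
    (T t₁ : ℝ) (hT : T = 1 + Real.sqrt 6) (ht₁ : t₁ = 1 + Real.sqrt 6 / 2)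
    (u : ℝ → ℝ) (hu : ∀ t, u t = if t < t₁ then (-1 : ℝ) else 1)
    (p v : ℝ → ℝ) (hp0 : p 0 = 1) (hv0 : v 0 = 1)
    (hpc : ContinuousOn p (Set.Icc 0 T)) (hvc : ContinuousOn v (Set.Icc 0 T))
    (hpd : ∀ t ∈ Set.Ioo (0 : ℝ) T, HasDerivAt p (v t) t)
    (hvd : ∀ t ∈ Set.Ioo (0 : ℝ) T, t ≠ t₁ → HasDerivAt v (u t) t) :
    p T = 0 ∧ v T = 0 := by
  have h6 : Real.sqrt 6 ^ 2 = 6 := Real.sq_sqrt (by norm_num)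
  have hpos : 0 < Real.sqrt 6 := Real.sqrt_pos.2 (by norm_num)
  have h0 : 0 < t₁ := by linarith
  have h1 : t₁ < T := by linarith
  have hl : Set.Icc 0 t₁ ⊆ Set.Icc 0 T := Set.Icc_subset_Icc_right h1.le
  have hr : Set.Icc t₁ T ⊆ Set.Icc 0 T := Set.Icc_subset_Icc_left h0.le
  have hvl := eq_quadratic_of_hasDerivAt_affine (c := -1) (k := 0) (hvc.mono hl) fun t ht => by
    simpa [hu, ht.2] using hvd t ⟨ht.1, ht.2.trans h1⟩ ht.2.ne
  have hvr := eq_quadratic_of_hasDerivAt_affine (c := 1) (k := 0) (hvc.mono hr) fun t ht => by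
    simpa [hu, ht.1.not_gt] using hvd t ⟨h0.trans ht.1, ht.2⟩ ht.1.ne'
  have hpl := eq_quadratic_of_hasDerivAt_affine (c := 1) (k := -1) (hpc.mono hl) fun t ht => by
    convert hpd t ⟨ht.1, ht.2.trans h1⟩ using 1
    rw [hvl t (Set.Ioo_subset_Icc_self ht), hv0]
    ring
  have hpr := eq_quadratic_of_hasDerivAt_affine (c := v t₁) (k := 1) (hpc.mono hr) fun t ht => by
    convert hpd t ⟨h0.trans ht.1, ht.2⟩ using 1
    rw [hvr t (Set.Ioo_subset_Icc_self ht)]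
    ring
  have hv₁ := hvl t₁ (Set.right_mem_Icc.2 h0.le)
  have hp₁ := hpl t₁ (Set.right_mem_Icc.2 h0.le)
  rw [hpr T (Set.right_mem_Icc.2 h1.le), hvr T (Set.right_mem_Icc.2 h1.le), hp₁, hv₁, hp0, hv0,
    hT, ht₁]
  constructor
  · linear_combination (-1 / 4) * h6
  · ring
end

section
/- Consider the double integrator control system p′(t) = v(t), v′(t) = u(t) with initial conditions p(0) = 1, v(0) = 1, where u : [0, T] → ℝ is measurable with |u(t)| ≤ 1 for almost every t, and p, v are the corresponding absolutely continuous trajectory. If T > 0 is such that there exists an admissible control u steering the state from (1, 1) at time 0 to p(T) = 0 and v(T) = 0, then T ≥ 1 + √6. Consequently, 1 + √6 is the infimum (and, by attainability, the minimum) of the transfer times from (1,1) to the origin. -/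
open MeasureTheory

/-- Double integrator, optimality: if a measurable control `u` with `|u t| ≤ 1`
a.e. steers the absolutely continuous trajectory of `p' = v`, `v' = u` from
`(p, v) = (1, 1)` at time `0` to the origin at time `T > 0`, then `T ≥ 1 + √6`;
hence `1 + √6` is the minimal transfer time. -/
theorem doubleIntegrator_minimal_time_lower_bound
    (T : ℝ) (hT : 0 < T)
    (u p v : ℝ → ℝ)
    (hu_int : IntervalIntegrable u volume 0 T)
    (hu_bdd : ∀ᵐ t ∂volume, t ∈ Set.Icc (0 : ℝ) T → |u t| ≤ 1)
    (hv : ∀ t ∈ Set.Icc (0 : ℝ) T, v t = 1 + ∫ s in (0 : ℝ)..t, u s)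
    (hp : ∀ t ∈ Set.Icc (0 : ℝ) T, p t = 1 + ∫ s in (0 : ℝ)..t, v s)
    (hpT : p T = 0) (hvT : v T = 0) :
    1 + Real.sqrt 6 ≤ T := by
  have hsub : ∀ a b, 0 ≤ a → a ≤ b → b ≤ T → IntervalIntegrable u volume a b := by
    intro a b ha hab hb
    refine hu_int.mono_set ?_
    rw [Set.uIcc_of_le hab, Set.uIcc_of_le hT.le]
    exact Set.Icc_subset_Icc ha hb
  have hincr : ∀ a b, 0 ≤ a → a ≤ b → b ≤ T → |v b - v a| ≤ b - a := by
    intro a b ha hab hb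
    rw [hv b ⟨ha.trans hab, hb⟩, hv a ⟨ha, hab.trans hb⟩, add_sub_add_left_eq_sub,
      intervalIntegral.integral_interval_sub_left (hsub 0 b le_rfl (ha.trans hab) hb)
        (hsub 0 a le_rfl ha (hab.trans hb)), ← Real.norm_eq_abs]
    have h := intervalIntegral.norm_integral_le_of_norm_le_const_ae (f := u) (a := a) (b := b)
      (C := 1) (by
        filter_upwards [hu_bdd] with t ht hmem
        rw [Set.uIoc_of_le hab] at hmem
        exact ht ⟨ha.trans hmem.1.le, hmem.2.trans hb⟩)
    rwa [one_mul, abs_of_nonneg (sub_nonneg.2 hab)] at h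
  have hv0 : v 0 = 1 := by simpa using hv 0 ⟨le_rfl, hT.le⟩
  have hlow : ∀ t ∈ Set.Icc (0 : ℝ) T, 1 - t ≤ v t ∧ t - T ≤ v t := by
    intro t ht
    have h₁ := abs_le.1 (hincr 0 t le_rfl ht.1 ht.2)
    have h₂ := abs_le.1 (hincr t T ht.1 ht.2 le_rfl)
    constructor <;> linarith [h₁.1, h₂.2]
  have hcont : ContinuousOn v (Set.Icc 0 T) := by
    refine (LipschitzOnWith.of_dist_le_mul (K := 1) fun x hx y hy => ?_).continuousOn
    rw [NNReal.coe_one, one_mul, Real.dist_eq, Real.dist_eq]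
    rcases le_total x y with h | h
    · rw [abs_sub_comm, abs_sub_comm x y]
      exact (hincr x y hx.1 h hy.2).trans (le_abs_self _)
    · exact (hincr y x hy.1 h hx.2).trans (le_abs_self _)
  have hT1 : 1 ≤ T := by linarith [(hlow T ⟨hT.le, le_rfl⟩).1]
  have hs0 : 0 ≤ (1 + T) / 2 := by linarith
  have hsT : (1 + T) / 2 ≤ T := by linarith
  have hv₁ : IntervalIntegrable v volume 0 ((1 + T) / 2) :=
    (hcont.mono (Set.Icc_subset_Icc le_rfl hsT)).intervalIntegrable_of_Icc hs0
  have hv₂ : IntervalIntegrable v volume ((1 + T) / 2) T :=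
    (hcont.mono (Set.Icc_subset_Icc hs0 le_rfl)).intervalIntegrable_of_Icc hsT
  have hI₁ : ∫ t in (0 : ℝ)..((1 + T) / 2), (1 - t) ≤ ∫ t in (0 : ℝ)..((1 + T) / 2), v t :=
    intervalIntegral.integral_mono_on hs0 (Continuous.intervalIntegrable (by fun_prop) _ _) hv₁
      fun t ht => (hlow t ⟨ht.1, ht.2.trans hsT⟩).1
  have hI₂ : ∫ t in ((1 + T) / 2)..T, (t - T) ≤ ∫ t in ((1 + T) / 2)..T, v t :=
    intervalIntegral.integral_mono_on hsT (Continuous.intervalIntegrable (by fun_prop) _ _) hv₂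
      fun t ht => (hlow t ⟨hs0.trans ht.1, ht.2⟩).2
  rw [intervalIntegral.integral_sub intervalIntegrable_const intervalIntegral.intervalIntegrable_id,
    intervalIntegral.integral_const, integral_id, smul_eq_mul] at hI₁
  rw [intervalIntegral.integral_sub intervalIntegral.intervalIntegrable_id intervalIntegrable_const,
    intervalIntegral.integral_const, integral_id, smul_eq_mul] at hI₂
  have hpT' := hp T ⟨hT.le, le_rfl⟩
  rw [← intervalIntegral.integral_add_adjacent_intervals hv₁ hv₂, hpT] at hpT'
  have hsqrt : Real.sqrt 6 ≤ T - 1 := Real.sqrt_le_iff.2 ⟨by linarith, by nlinarith⟩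
  linarith
end
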